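/- arXiv:1207.4013 — 3 statements merged into one kernel-verified Lean document; each statement's English description precedes it below -/
import Mathlib

section
/- In the abstract setting, the assignment X ↦ X_0 (the 0-th component) induces a well-defined R-linear map from ℰ^p to K^p/(I^p + d(K^{p−1})) which vanishes on b(ℰ^p), and the induced map ℰ^p / b(ℰ^p) → K^p/(I^p + d(K^{p−1})) is injective. -/
/-! Abstract setting for the paper's relative Brieskorn complexes.

`Ω` is a cochain complex of `R`-modules, graded by `ℤ` and vanishing in
negative degrees (this encodes the paper's conventions `Ω^p` for `p ∈ ℕ`,
`K^{-1} := 0`, `I^0 := 0`, `𝒦^{-1} := 0`), with two anticommuting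
differentials `d` (the relative de Rham differential) and `e` (exterior
multiplication by `d_{/S} f`). -/

section AbstractSetting

variable {R : Type*} [CommRing R] {Ω : ℤ → Type*}
  [∀ i, AddCommGroup (Ω i)] [∀ i, Module R (Ω i)]

/-- The space `𝒦^p` of formal series `Σ_j b^j ω_j` with `e(ω_0) = 0`,
as a submodule of the module of sequences `ℕ → Ω p`. -/
def KSeq (e : ∀ i : ℤ, Ω i →ₗ[R] Ω (i + 1)) (p : ℤ) :
    Submodule R (ℕ → Ω p) where
  carrier := {ω | e p (ω 0) = 0}
  add_mem' := by
    intro x y hx hy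
    simp only [Set.mem_setOf_eq, Pi.add_apply, map_add] at *
    rw [hx, hy, add_zero]
  zero_mem' := by simp
  smul_mem' := by
    intro c x hx
    simp only [Set.mem_setOf_eq, Pi.smul_apply, map_smul] at *
    rw [hx, smul_zero]

/-- The differential `D` on sequences: `(D ω)_j = d(ω_j) - e(ω_{j+1})`. -/
def Dop (d e : ∀ i : ℤ, Ω i →ₗ[R] Ω (i + 1)) (p : ℤ) :
    (ℕ → Ω p) →ₗ[R] (ℕ → Ω (p + 1)) where
  toFun ω := fun j => d p (ω j) - e p (ω (j + 1))
  map_add' x y := by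
    funext j
    simp only [Pi.add_apply, map_add]
    abel
  map_smul' c x := by
    funext j
    simp only [Pi.smul_apply, map_smul, RingHom.id_apply, smul_sub]

/-- The shift operator `b` on sequences: `(b ω)_0 = 0`, `(b ω)_j = ω_{j-1}`. -/
def bShift {p : ℤ} (ω : ℕ → Ω p) : ℕ → Ω p
  | 0 => 0
  | (k + 1) => ω k

/-- The sequence `(x, 0, 0, …)`, i.e. the chain map `u : K^p → 𝒦^p`. -/
def unitSeq {p : ℤ} (x : Ω p) : ℕ → Ω p
  | 0 => x
  | (_ + 1) => 0

/-- The submodule of finitely supported sequences (`𝒦^{0,p}` inside `𝒦^p`). -/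
def finSuppSeq (p : ℤ) : Submodule R (ℕ → Ω p) where
  carrier := {ω | ∃ N : ℕ, ∀ j : ℕ, N ≤ j → ω j = 0}
  add_mem' := by
    rintro x y ⟨Nx, hx⟩ ⟨Ny, hy⟩
    exact ⟨max Nx Ny, fun j hj => by
      simp [hx j (le_trans (le_max_left _ _) hj), hy j (le_trans (le_max_right _ _) hj)]⟩
  zero_mem' := ⟨0, fun j _ => rfl⟩
  smul_mem' := by
    rintro c x ⟨Nx, hx⟩
    exact ⟨Nx, fun j hj => by simp [hx j hj]⟩

/-- The cocycles `Z^p = K^p ∩ ker d` of the complex `(K^•, d)`. -/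
def Zmod (d e : ∀ i : ℤ, Ω i →ₗ[R] Ω (i + 1)) (p : ℤ) : Submodule R (Ω p) :=
  LinearMap.ker (e p) ⊓ LinearMap.ker (d p)

/-- The coboundaries `d(K^{p-1})` of the complex `(K^•, d)` (in degree `q+1`). -/
def Bmod (d e : ∀ i : ℤ, Ω i →ₗ[R] Ω (i + 1)) (q : ℤ) : Submodule R (Ω (q + 1)) :=
  Submodule.map (d q) (LinearMap.ker (e q))

/-- The cohomology `E^{q+1} = (K^{q+1} ∩ ker d) / d(K^q)`. -/
abbrev Emod (d e : ∀ i : ℤ, Ω i →ₗ[R] Ω (i + 1)) (q : ℤ) :=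
  Zmod d e (q + 1) ⧸ Submodule.comap (Zmod d e (q + 1)).subtype (Bmod d e q)

/-- The `D`-cocycles in `𝒦^p`. -/
def ZSeq (d e : ∀ i : ℤ, Ω i →ₗ[R] Ω (i + 1)) (p : ℤ) : Submodule R (ℕ → Ω p) :=
  KSeq e p ⊓ LinearMap.ker (Dop d e p)

/-- The `D`-coboundaries `D(𝒦^q)` in degree `q+1`. -/
def BSeq (d e : ∀ i : ℤ, Ω i →ₗ[R] Ω (i + 1)) (q : ℤ) : Submodule R (ℕ → Ω (q + 1)) :=
  Submodule.map (Dop d e q) (KSeq e q)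

/-- The cohomology `ℰ^{q+1} = ker(D : 𝒦^{q+1} → 𝒦^{q+2}) / D(𝒦^q)`. -/
abbrev ESeq (d e : ∀ i : ℤ, Ω i →ₗ[R] Ω (i + 1)) (q : ℤ) :=
  ZSeq d e (q + 1) ⧸ Submodule.comap (ZSeq d e (q + 1)).subtype (BSeq d e q)

end AbstractSetting

section Helpers

variable {R : Type*} [CommRing R] {Ω : ℤ → Type*}
  [∀ i, AddCommGroup (Ω i)] [∀ i, Module R (Ω i)]

lemma Dop_Dop (d e : ∀ i : ℤ, Ω i →ₗ[R] Ω (i + 1))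
    (hdd : ∀ (i : ℤ) (x : Ω i), d (i + 1) (d i x) = 0)
    (hee : ∀ (i : ℤ) (x : Ω i), e (i + 1) (e i x) = 0)
    (hde : ∀ (i : ℤ) (x : Ω i), d (i + 1) (e i x) = - e (i + 1) (d i x))
    (q : ℤ) (W : ℕ → Ω q) : Dop d e (q + 1) (Dop d e q W) = 0 := by
  funext j
  simp [Dop, hdd, hee, hde]

lemma Dop_mem_ZSeq (d e : ∀ i : ℤ, Ω i →ₗ[R] Ω (i + 1))
    (hdd : ∀ (i : ℤ) (x : Ω i), d (i + 1) (d i x) = 0)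
    (hee : ∀ (i : ℤ) (x : Ω i), e (i + 1) (e i x) = 0)
    (hde : ∀ (i : ℤ) (x : Ω i), d (i + 1) (e i x) = - e (i + 1) (d i x))
    (q : ℤ) {W : ℕ → Ω q} (hW : W ∈ KSeq e q) : Dop d e q W ∈ ZSeq d e (q + 1) := by
  refine ⟨?_, Dop_Dop d e hdd hee hde q W⟩
  have h0 : e q (W 0) = 0 := hW
  have h1 : e (q + 1) (d q (W 0)) = 0 := by
    rw [← neg_eq_zero, ← hde, h0, map_zero]
  change e (q + 1) (d q (W 0) - e q (W 1)) = 0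
  rw [map_sub, h1, hee, sub_zero]

/-- A `D`-cocycle with vanishing zeroth component is the shift of a `D`-cocycle in `𝒦^p`. -/
lemma exists_bShift_eq_of_apply_zero_eq_zero (d e : ∀ i : ℤ, Ω i →ₗ[R] Ω (i + 1))
    {p : ℤ} {X : ℕ → Ω p} (hX : X ∈ ZSeq d e p) (h0 : X 0 = 0) :
    ∃ Y ∈ ZSeq d e p, bShift Y = X := by
  have hD : ∀ j, d p (X j) - e p (X (j + 1)) = 0 := fun j => congrFun hX.2 j
  refine ⟨fun j => X (j + 1), ⟨?_, funext fun j => hD (j + 1)⟩, ?_⟩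
  · have h := hD 0
    rw [h0, map_zero, zero_sub, neg_eq_zero] at h
    exact h
  · funext j
    cases j with
    | zero => exact h0.symm
    | succ j => rfl

/-- The zeroth component, as a linear map from the `D`-cocycles to `ker e`. -/
def zerothComponent (d e : ∀ i : ℤ, Ω i →ₗ[R] Ω (i + 1)) (p : ℤ) :
    ZSeq d e p →ₗ[R] LinearMap.ker (e p) where
  toFun X := ⟨X.1 0, X.2.1⟩
  map_add' _ _ := rfl
  map_smul' _ _ := rfl

lemma comap_BSeq_le_comap_zerothComponent (d e : ∀ i : ℤ, Ω i →ₗ[R] Ω (i + 1)) (q : ℤ) :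
    Submodule.comap (ZSeq d e (q + 1)).subtype (BSeq d e q) ≤
      Submodule.comap (zerothComponent d e (q + 1))
        (Submodule.comap (LinearMap.ker (e (q + 1))).subtype
          (LinearMap.range (e q) ⊔ Submodule.map (d q) (LinearMap.ker (e q)))) := by
  intro X hX
  obtain ⟨W, hW, hWX⟩ := Submodule.mem_comap.1 hX
  have h : d q (W 0) - e q (W 1) = X.1 0 := congrFun hWX 0
  rw [Submodule.mem_comap, Submodule.mem_comap]
  change X.1 0 ∈ _
  rw [← h]
  exact Submodule.sub_mem _
    (Submodule.mem_sup_right (Submodule.mem_map_of_mem hW))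
    (Submodule.mem_sup_left (LinearMap.mem_range_self _ _))

/-- Every element of `I^p + d(K^{p-1})` is the zeroth component of a `D`-coboundary. -/
lemma exists_Dop_apply_zero_eq (d e : ∀ i : ℤ, Ω i →ₗ[R] Ω (i + 1)) (q : ℤ)
    {x : Ω (q + 1)}
    (hx : x ∈ LinearMap.range (e q) ⊔ Submodule.map (d q) (LinearMap.ker (e q))) :
    ∃ W ∈ KSeq e q, Dop d e q W 0 = x := by
  obtain ⟨_, ⟨a, rfl⟩, _, ⟨k, hk, rfl⟩, rfl⟩ := Submodule.mem_sup.1 hx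
  refine ⟨fun j => if j = 0 then k else -a, ?_, ?_⟩
  · change e q k = 0
    exact hk
  · change d q k - e q (-a) = _
    rw [map_neg, sub_neg_eq_add]
    exact add_comm _ _

end Helpers

/-- paper's Corollary "inj. coh.".
The 0-th component `X ↦ X_0` induces a well-defined `R`-linear map
`ℰ^p → K^p/(I^p + d(K^{p-1}))` (here `p = q + 1`) which vanishes on `b(ℰ^p)`,
and the induced map `ℰ^p / b(ℰ^p) → K^p/(I^p + d(K^{p-1}))` is injective. -/
theorem brieskorn_zeroth_component_injective_mod_b
    {R : Type*} [CommRing R] {Ω : ℤ → Type*}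
    [∀ i, AddCommGroup (Ω i)] [∀ i, Module R (Ω i)]
    (hneg : ∀ i : ℤ, i < 0 → Subsingleton (Ω i))
    (d e : ∀ i : ℤ, Ω i →ₗ[R] Ω (i + 1))
    (hdd : ∀ (i : ℤ) (x : Ω i), d (i + 1) (d i x) = 0)
    (hee : ∀ (i : ℤ) (x : Ω i), e (i + 1) (e i x) = 0)
    (hde : ∀ (i : ℤ) (x : Ω i), d (i + 1) (e i x) = - e (i + 1) (d i x))
    (q : ℤ) :
    ∃ φ : ESeq d e q →ₗ[R]
        (LinearMap.ker (e (q + 1)) ⧸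
          Submodule.comap (LinearMap.ker (e (q + 1))).subtype
            (LinearMap.range (e q) ⊔ Submodule.map (d q) (LinearMap.ker (e q)))),
      -- `φ` is induced by the 0-th component
      (∀ (X : ℕ → Ω (q + 1)) (hX : X ∈ ZSeq d e (q + 1))
          (h0 : X 0 ∈ LinearMap.ker (e (q + 1))),
        φ (Submodule.Quotient.mk ⟨X, hX⟩) = Submodule.Quotient.mk ⟨X 0, h0⟩) ∧
      -- `φ` vanishes on `b(ℰ^p)`
      (∀ (Y : ℕ → Ω (q + 1)) (hY : Y ∈ ZSeq d e (q + 1))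
          (hbY : bShift Y ∈ ZSeq d e (q + 1)),
        φ (Submodule.Quotient.mk ⟨bShift Y, hbY⟩) = 0) ∧
      -- the induced map `ℰ^p / b(ℰ^p) → K^p/(I^p + d(K^{p-1}))` is injective
      (∀ c : ESeq d e q, φ c = 0 →
        ∃ (Y : ℕ → Ω (q + 1)) (hY : Y ∈ ZSeq d e (q + 1))
          (hbY : bShift Y ∈ ZSeq d e (q + 1)),
          c = Submodule.Quotient.mk ⟨bShift Y, hbY⟩) := by
  refine ⟨Submodule.mapQ _ _ (zerothComponent d e (q + 1))
    (comap_BSeq_le_comap_zerothComponent d e q), fun X hX h0 => rfl, ?_, ?_⟩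
  · intro Y hY hbY
    exact (Submodule.Quotient.mk_eq_zero _).2 (Submodule.zero_mem _)
  · intro c hc
    obtain ⟨⟨X, hX⟩, rfl⟩ := Submodule.mkQ_surjective _ c
    have hX0 : X 0 ∈ LinearMap.range (e q) ⊔ Submodule.map (d q) (LinearMap.ker (e q)) := by
      rw [Submodule.mkQ_apply, Submodule.mapQ_apply, Submodule.Quotient.mk_eq_zero] at hc
      exact hc
    obtain ⟨W, hW, hW0⟩ := exists_Dop_apply_zero_eq d e q hX0
    have h0 : (X - Dop d e q W) 0 = 0 := by
      rw [Pi.sub_apply, hW0]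
      exact sub_self (X 0)
    obtain ⟨Y, hY, hYX⟩ := exists_bShift_eq_of_apply_zero_eq_zero d e
      (Submodule.sub_mem _ hX (Dop_mem_ZSeq d e hdd hee hde q hW)) h0
    have hbY : bShift Y ∈ ZSeq d e (q + 1) := by
      rw [hYX]
      exact Submodule.sub_mem _ hX (Dop_mem_ZSeq d e hdd hee hde q hW)
    refine ⟨Y, hY, hbY, (Submodule.Quotient.eq _).2 ?_⟩
    change X - bShift Y ∈ BSeq d e q
    rw [hYX, sub_sub_cancel]
    exact Submodule.mem_map_of_mem hW
end

section
/- In the abstract setting, assume (Ω^•, d) is exact in positive degrees, let p ≥ 2, and let a : Ω^q → Ω^q (for all q) be R-linear maps with e∘a = a∘e and d∘a = a∘d + e. Then a maps K^p ∩ ker d into itself and d(K^{p−1}) into itself, hence induces an R-linear endomorphism a of E^p, and the endomorphisms a and b of E^p satisfy a ∘ b − b ∘ a = b ∘ b. -/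
section Endomorphisms

variable {R : Type*} [CommRing R] {Ω : ℤ → Type*}
  [∀ i, AddCommGroup (Ω i)] [∀ i, Module R (Ω i)]
  {d e : ∀ i : ℤ, Ω i →ₗ[R] Ω (i + 1)}

theorem mem_Zmod {p : ℤ} {x : Ω p} : x ∈ Zmod d e p ↔ e p x = 0 ∧ d p x = 0 :=
  Iff.rfl

theorem mem_Bmod {q : ℤ} {x : Ω (q + 1)} :
    x ∈ Bmod d e q ↔ ∃ η : Ω q, e q η = 0 ∧ d q η = x :=
  Iff.rfl

theorem map_mem_Zmod {a : ∀ i : ℤ, Ω i →ₗ[R] Ω i}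
    (hea : ∀ (i : ℤ) (x : Ω i), e i (a i x) = a (i + 1) (e i x))
    (hda : ∀ (i : ℤ) (x : Ω i), d i (a i x) = a (i + 1) (d i x) + e i x)
    {p : ℤ} {x : Ω p} (hx : x ∈ Zmod d e p) : a p x ∈ Zmod d e p := by
  obtain ⟨h₁, h₂⟩ := mem_Zmod.1 hx
  exact mem_Zmod.2 ⟨by rw [hea, h₁, map_zero], by rw [hda, h₁, h₂, map_zero, add_zero]⟩

theorem map_mem_Bmod {a : ∀ i : ℤ, Ω i →ₗ[R] Ω i}
    (hea : ∀ (i : ℤ) (x : Ω i), e i (a i x) = a (i + 1) (e i x))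
    (hda : ∀ (i : ℤ) (x : Ω i), d i (a i x) = a (i + 1) (d i x) + e i x)
    {q : ℤ} {x : Ω (q + 1)} (hx : x ∈ Bmod d e q) : a (q + 1) x ∈ Bmod d e q := by
  obtain ⟨η, hη, rfl⟩ := mem_Bmod.1 hx
  exact mem_Bmod.2 ⟨a q η, by rw [hea, hη, map_zero], by rw [hda, hη, add_zero]⟩

theorem e_mem_Zmod
    (hee : ∀ (i : ℤ) (x : Ω i), e (i + 1) (e i x) = 0)
    (hde : ∀ (i : ℤ) (x : Ω i), d (i + 1) (e i x) = - e (i + 1) (d i x))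
    {q : ℤ} {ξ : Ω q} (hξ : d q ξ ∈ Zmod d e (q + 1)) : e q ξ ∈ Zmod d e (q + 1) :=
  mem_Zmod.2 ⟨hee q ξ, by rw [hde, (mem_Zmod.1 hξ).1, neg_zero]⟩

/-- If `dξ` is a coboundary of `(K^•, d)` then so is `eξ`: the class of `eξ` depends only on
that of `dξ`. -/
theorem e_mem_Bmod_of_d_mem_Bmod
    (hee : ∀ (i : ℤ) (x : Ω i), e (i + 1) (e i x) = 0)
    (hde : ∀ (i : ℤ) (x : Ω i), d (i + 1) (e i x) = - e (i + 1) (d i x))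
    {r : ℤ} (hex : ∀ y : Ω (r + 1), d (r + 1) y = 0 → ∃ x : Ω r, d r x = y)
    {ξ : Ω (r + 1)} (hξ : d (r + 1) ξ ∈ Bmod d e (r + 1)) :
    e (r + 1) ξ ∈ Bmod d e (r + 1) := by
  obtain ⟨η, hη, hdη⟩ := mem_Bmod.1 hξ
  obtain ⟨ζ, hζ⟩ := hex (ξ - η) (by rw [map_sub, hdη, sub_self])
  refine mem_Bmod.2 ⟨-e r ζ, by rw [map_neg, hee, neg_zero], ?_⟩
  rw [map_neg, hde, hζ, map_sub, hη, sub_zero, neg_neg]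

/-- The endomorphism `[dξ] ↦ [eξ]` of `E^{r+2}`. -/
theorem exists_bEndomorphism
    (hee : ∀ (i : ℤ) (x : Ω i), e (i + 1) (e i x) = 0)
    (hde : ∀ (i : ℤ) (x : Ω i), d (i + 1) (e i x) = - e (i + 1) (d i x))
    {r : ℤ} (hex : ∀ y : Ω (r + 1), d (r + 1) y = 0 → ∃ x : Ω r, d r x = y)
    (hex' : ∀ y : Ω (r + 1 + 1), d (r + 1 + 1) y = 0 → ∃ x : Ω (r + 1), d (r + 1) x = y) :
    ∃ bE : Emod d e (r + 1) →ₗ[R] Emod d e (r + 1),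
      ∀ (x : Ω (r + 1 + 1)) (hx : x ∈ Zmod d e (r + 1 + 1)) (ξ : Ω (r + 1))
        (_ : d (r + 1) ξ = x) (he : e (r + 1) ξ ∈ Zmod d e (r + 1 + 1)),
        bE (Submodule.Quotient.mk ⟨x, hx⟩) = Submodule.Quotient.mk ⟨e (r + 1) ξ, he⟩ := by
  choose s hs using fun x : Zmod d e (r + 1 + 1) => hex' x (mem_Zmod.1 x.2).2
  have hsZ (x : Zmod d e (r + 1 + 1)) : e (r + 1) (s x) ∈ Zmod d e (r + 1 + 1) :=
    e_mem_Zmod hee hde (by rw [hs]; exact x.2)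
  let f : Zmod d e (r + 1 + 1) →ₗ[R] Emod d e (r + 1) :=
    { toFun := fun x => Submodule.Quotient.mk ⟨e (r + 1) (s x), hsZ x⟩
      map_add' := fun x y => by
        rw [← Submodule.Quotient.mk_add, Submodule.Quotient.eq]
        change e (r + 1) (s (x + y)) - (e (r + 1) (s x) + e (r + 1) (s y)) ∈ Bmod d e (r + 1)
        rw [← map_add, ← map_sub]
        refine e_mem_Bmod_of_d_mem_Bmod hee hde hex ?_
        simp [hs]
      map_smul' := fun c x => by
        rw [RingHom.id_apply, ← Submodule.Quotient.mk_smul, Submodule.Quotient.eq]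
        change e (r + 1) (s (c • x)) - c • e (r + 1) (s x) ∈ Bmod d e (r + 1)
        rw [← map_smul, ← map_sub]
        refine e_mem_Bmod_of_d_mem_Bmod hee hde hex ?_
        simp [hs] }
  refine ⟨Submodule.liftQ _ f fun x hx => ?_, fun x hx ξ hξ he => ?_⟩
  · refine (Submodule.Quotient.mk_eq_zero _).2 ?_
    refine e_mem_Bmod_of_d_mem_Bmod hee hde hex ?_
    rw [hs]
    exact hx
  · refine (Submodule.Quotient.eq _).2 ?_
    change e (r + 1) (s ⟨x, hx⟩) - e (r + 1) ξ ∈ Bmod d e (r + 1)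
    rw [← map_sub]
    refine e_mem_Bmod_of_d_mem_Bmod hee hde hex ?_
    simp [hs, hξ]

end Endomorphisms

/-- formula (F) of the paper's Lemma "Tilde b": the relation
`a∘b - b∘a = b∘b` on cohomology.  Assume `(Ω^•, d)` is exact in positive
degrees, `p ≥ 2` (here `p = r + 2` with `r ≥ 0`), and let `a` satisfy
`e∘a = a∘e` and `d∘a = a∘d + e`.  Then `a` maps `K^p ∩ ker d` and `d(K^{p-1})`
into themselves, hence induces an endomorphism of `E^p`, and the induced
endomorphisms satisfy `a ∘ b - b ∘ a = b ∘ b`. -/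
theorem brieskorn_a_b_commutation_on_cohomology
    {R : Type*} [CommRing R] {Ω : ℤ → Type*}
    [∀ i, AddCommGroup (Ω i)] [∀ i, Module R (Ω i)]
    (hneg : ∀ i : ℤ, i < 0 → Subsingleton (Ω i))
    (d e : ∀ i : ℤ, Ω i →ₗ[R] Ω (i + 1))
    (a : ∀ i : ℤ, Ω i →ₗ[R] Ω i)
    (hdd : ∀ (i : ℤ) (x : Ω i), d (i + 1) (d i x) = 0)
    (hee : ∀ (i : ℤ) (x : Ω i), e (i + 1) (e i x) = 0)
    (hde : ∀ (i : ℤ) (x : Ω i), d (i + 1) (e i x) = - e (i + 1) (d i x))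
    (hea : ∀ (i : ℤ) (x : Ω i), e i (a i x) = a (i + 1) (e i x))
    (hda : ∀ (i : ℤ) (x : Ω i), d i (a i x) = a (i + 1) (d i x) + e i x)
    (hex : ∀ i : ℤ, 0 ≤ i → ∀ y : Ω (i + 1), d (i + 1) y = 0 →
      ∃ x : Ω i, d i x = y)
    (r : ℤ) (hr : 0 ≤ r) :
    -- `a` preserves the cocycles `K^p ∩ ker d`
    (∀ x : Ω (r + 1 + 1), x ∈ Zmod d e (r + 1 + 1) →
      a (r + 1 + 1) x ∈ Zmod d e (r + 1 + 1)) ∧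
    -- `a` preserves the coboundaries `d(K^{p-1})`
    (∀ x : Ω (r + 1 + 1), x ∈ Bmod d e (r + 1) →
      a (r + 1 + 1) x ∈ Bmod d e (r + 1)) ∧
    -- the induced endomorphisms of `E^p` satisfy `a∘b - b∘a = b∘b`
    (∃ aE bE : Emod d e (r + 1) →ₗ[R] Emod d e (r + 1),
      (∀ (x : Ω (r + 1 + 1)) (hx : x ∈ Zmod d e (r + 1 + 1))
          (hax : a (r + 1 + 1) x ∈ Zmod d e (r + 1 + 1)),
        aE (Submodule.Quotient.mk ⟨x, hx⟩) =
          Submodule.Quotient.mk ⟨a (r + 1 + 1) x, hax⟩) ∧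
      (∀ (x : Ω (r + 1 + 1)) (hx : x ∈ Zmod d e (r + 1 + 1)) (ξ : Ω (r + 1))
          (hξ : d (r + 1) ξ = x) (he : e (r + 1) ξ ∈ Zmod d e (r + 1 + 1)),
        bE (Submodule.Quotient.mk ⟨x, hx⟩) =
          Submodule.Quotient.mk ⟨e (r + 1) ξ, he⟩) ∧
      aE ∘ₗ bE - bE ∘ₗ aE = bE ∘ₗ bE) := by
  have haZ : ∀ x ∈ Zmod d e (r + 1 + 1), a (r + 1 + 1) x ∈ Zmod d e (r + 1 + 1) :=
    fun _ hx => map_mem_Zmod hea hda hx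
  have haB : ∀ x ∈ Bmod d e (r + 1), a (r + 1 + 1) x ∈ Bmod d e (r + 1) :=
    fun _ hx => map_mem_Bmod hea hda hx
  have hex' := hex (r + 1) (by lia)
  obtain ⟨bE, hbE⟩ := exists_bEndomorphism hee hde (hex r hr) hex'
  let aE : Emod d e (r + 1) →ₗ[R] Emod d e (r + 1) :=
    Submodule.mapQ _ _ ((a (r + 1 + 1)).restrict haZ) fun x hx => haB x hx
  have haE (x : Ω (r + 1 + 1)) (hx : x ∈ Zmod d e (r + 1 + 1)) :
      aE (Submodule.Quotient.mk ⟨x, hx⟩) =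
        Submodule.Quotient.mk ⟨a (r + 1 + 1) x, haZ x hx⟩ := rfl
  refine ⟨haZ, haB, aE, bE, fun x hx _ => haE x hx, hbE, ?_⟩
  refine LinearMap.ext fun z => ?_
  obtain ⟨⟨x, hx⟩, rfl⟩ := Submodule.Quotient.mk_surjective _ z
  obtain ⟨ξ, rfl⟩ := hex' x (mem_Zmod.1 hx).2
  have hξ := e_mem_Zmod hee hde hx
  obtain ⟨η, hη⟩ := hex' (e (r + 1) ξ) (mem_Zmod.1 hξ).2
  have hηZ : e (r + 1) η ∈ Zmod d e (r + 1 + 1) := e_mem_Zmod hee hde (hη ▸ hξ)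
  have had : d (r + 1) (a (r + 1) ξ - η) = a (r + 1 + 1) (d (r + 1) ξ) := by
    rw [map_sub, hda, hη, add_sub_cancel_right]
  have hadZ : e (r + 1) (a (r + 1) ξ - η) ∈ Zmod d e (r + 1 + 1) :=
    e_mem_Zmod hee hde (had ▸ haZ _ hx)
  simp only [LinearMap.sub_apply, LinearMap.comp_apply]
  rw [hbE _ hx ξ rfl hξ, haE _ hξ, haE _ hx, hbE _ (haZ _ hx) _ had hadZ, hbE _ hξ η hη hηZ,
    ← Submodule.Quotient.mk_sub]
  congr 1
  refine Subtype.ext ?_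
  change a (r + 1 + 1) (e (r + 1) ξ) - e (r + 1) (a (r + 1) ξ - η) = e (r + 1) η
  rw [map_sub, hea, sub_sub_cancel]
end

section
/- In the abstract setting, let N ∈ ℕ and suppose that every b-torsion class of ℰ^p is killed by b^N, i.e. every c ∈ ℰ^p with b^k c = 0 for some k ∈ ℕ satisfies b^N c = 0. Then ⋂_{m} b^m(ℰ^p) = {0}. -/
section CompletedSum

variable {R : Type*} [CommRing R] {Ω : ℤ → Type*}
  [∀ i, AddCommGroup (Ω i)] [∀ i, Module R (Ω i)]

/-- The shift preserves `D`-cocycles. -/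
theorem bShift_mem_ZSeq {d e : ∀ i : ℤ, Ω i →ₗ[R] Ω (i + 1)} {p : ℤ} {X : ℕ → Ω p}
    (hX : X ∈ ZSeq d e p) : bShift X ∈ ZSeq d e p := by
  obtain ⟨hK, hD⟩ := hX
  refine ⟨map_zero (e p), ?_⟩
  rw [SetLike.mem_coe, LinearMap.mem_ker] at hD ⊢
  funext j
  cases j with
  | zero =>
    have h0 : e p (X 0) = 0 := hK
    simp [Dop, bShift, h0]
  | succ j => exact congrFun hD j

/-- The `b`-adically convergent sum `∑ₖ b^k η_{n+k}`, computed coefficientwise. -/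
def bSum {p : ℤ} (η : ℕ → ℕ → Ω p) : ℕ → ℕ → Ω p
  | n, 0 => η n 0
  | n, j + 1 => η n (j + 1) + bSum η (n + 1) j

/-- If `Y_n - b Y_{n+1} = D η_n` for all `n`, then `D (∑ₖ b^k η_{n+k}) = Y_n`. -/
theorem Dop_bSum {d e : ∀ i : ℤ, Ω i →ₗ[R] Ω (i + 1)} {p : ℤ}
    {η : ℕ → ℕ → Ω p} {Y : ℕ → ℕ → Ω (p + 1)} (hη : ∀ n, η n ∈ KSeq e p)
    (hY : ∀ n, Dop d e p (η n) = Y n - bShift (Y (n + 1))) (n : ℕ) :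
    Dop d e p (bSum η n) = Y n := by
  funext j
  induction j generalizing n with
  | zero =>
    have h0 : e p (η (n + 1) 0) = 0 := hη (n + 1)
    have h1 := congrFun (hY n) 0
    simpa [Dop, bSum, bShift, h0] using h1
  | succ j ih =>
    have h1 : d p (η n (j + 1)) - e p (η n (j + 2)) = Y n (j + 1) - Y (n + 1) j :=
      congrFun (hY n) (j + 1)
    have h2 : d p (bSum η (n + 1) j) - e p (bSum η (n + 1) (j + 1)) = Y (n + 1) j := ih (n + 1)
    change d p (η n (j + 1) + bSum η (n + 1) j) -
      e p (η n (j + 2) + bSum η (n + 1) (j + 1)) = Y n (j + 1)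
    rw [map_add, map_add, add_sub_add_comm, h1, h2, sub_add_cancel]

end CompletedSum

/-- If the torsion of an endomorphism `f` is killed by `f ^ N`, every element of `⋂ₘ f^m(M)`
starts an infinite chain of successive preimages. -/
theorem exists_preimage_chain_of_torsion_bounded {R M : Type*} [CommRing R] [AddCommGroup M]
    [Module R M] {f : Module.End R M} {N : ℕ}
    (htor : ∀ c : M, (∃ k : ℕ, (f ^ k) c = 0) → (f ^ N) c = 0) {c : M}
    (hc : c ∈ ⨅ m : ℕ, LinearMap.range (f ^ m)) :
    ∃ u : ℕ → M, u 0 = c ∧ ∀ n, u n = f (u (n + 1)) := by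
  choose v hv using fun m => LinearMap.mem_range.mp ((Submodule.mem_iInf _).mp hc m)
  refine ⟨fun n => (f ^ N) (v (n + N)), by simpa using hv N, fun n => ?_⟩
  have h := htor (v (n + N) - f (v (n + 1 + N))) ⟨n + N, by
    rw [map_sub, ← Module.End.mul_apply, ← pow_succ, hv, show n + N + 1 = n + 1 + N by omega,
      hv, sub_self]⟩
  rw [map_sub, sub_eq_zero] at h
  change (f ^ N) (v (n + N)) = f ((f ^ N) (v (n + 1 + N)))
  rw [h, ← Module.End.mul_apply, ← Module.End.mul_apply, ← pow_succ, ← pow_succ']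

/-- paper's Lemma "b-separation2".
If every `b`-torsion class of `ℰ^p` is killed by `b^N` (here `p = q + 1`),
then `⋂ₘ b^m(ℰ^p) = {0}`. -/
theorem brieskorn_b_separated_of_b_torsion_bounded
    {R : Type*} [CommRing R] {Ω : ℤ → Type*}
    [∀ i, AddCommGroup (Ω i)] [∀ i, Module R (Ω i)]
    (hneg : ∀ i : ℤ, i < 0 → Subsingleton (Ω i))
    (d e : ∀ i : ℤ, Ω i →ₗ[R] Ω (i + 1))
    (hdd : ∀ (i : ℤ) (x : Ω i), d (i + 1) (d i x) = 0)
    (hee : ∀ (i : ℤ) (x : Ω i), e (i + 1) (e i x) = 0)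
    (hde : ∀ (i : ℤ) (x : Ω i), d (i + 1) (e i x) = - e (i + 1) (d i x))
    (q : ℤ) (N : ℕ)
    -- the shift-induced action of `b` on `ℰ^p`
    (bcalE : Module.End R (ESeq d e q))
    (hbcalE : ∀ (X : ℕ → Ω (q + 1)) (hX : X ∈ ZSeq d e (q + 1))
        (hb : bShift X ∈ ZSeq d e (q + 1)),
      bcalE (Submodule.Quotient.mk ⟨X, hX⟩) =
        Submodule.Quotient.mk ⟨bShift X, hb⟩)
    -- every `b`-torsion class is killed by `b^N`
    (htor : ∀ c : ESeq d e q, (∃ k : ℕ, (bcalE ^ k) c = 0) → (bcalE ^ N) c = 0) :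
    (⨅ m : ℕ, LinearMap.range (bcalE ^ m)) = ⊥ := by
  rw [eq_bot_iff]
  intro c hc
  obtain ⟨u, rfl, hu⟩ := exists_preimage_chain_of_torsion_bounded htor hc
  choose Y hYu using fun n => Submodule.Quotient.mk_surjective _ (u n)
  have hY : ∀ n, ∃ η ∈ KSeq e q,
      Dop d e q η = (Y n : ℕ → Ω (q + 1)) - bShift (Y (n + 1) : ℕ → Ω (q + 1)) := by
    intro n
    have h := hu n
    rw [← hYu n, ← hYu (n + 1),
      hbcalE _ (Y (n + 1)).2 (bShift_mem_ZSeq (Y (n + 1)).2), Submodule.Quotient.eq] at h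
    exact h
  choose η hηK hηD using hY
  rw [Submodule.mem_bot, ← hYu 0, Submodule.Quotient.mk_eq_zero]
  exact ⟨bSum η 0, (hηK 0 : e q (η 0 0) = 0),
    Dop_bSum (Y := fun n => (Y n : ℕ → Ω (q + 1))) hηK hηD 0⟩
end
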